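/- arXiv:1510.05089 — 2 statements merged into one kernel-verified Lean document; each statement's English description precedes it below -/
import Mathlib

section
/- For β ∈ (0,1), every partial sum of the Grünwald coefficients is strictly positive: ∑_{j=0}^{k} g_j^{(β)} > 0 for all k ≥ 0. -/
/-- Grünwald coefficient `g_j^(s) = ((-1)^j / j!) * s(s-1)⋯(s-j+1)` (with `g_0 = 1`). -/
noncomputable def grunwald (s : ℝ) (j : ℕ) : ℝ :=
  (-1) ^ j / (Nat.factorial j : ℝ) * ∏ i ∈ Finset.range j, (s - i)

theorem grunwald_succ (s : ℝ) (k : ℕ) :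
    grunwald s (k + 1) =
      -s * (∏ i ∈ Finset.range k, ((i : ℝ) + 1 - s)) / (Nat.factorial (k + 1) : ℝ) := by
  have h : ∏ i ∈ Finset.range k, ((i : ℝ) + 1 - s) =
      (-1) ^ k * ∏ i ∈ Finset.range k, (s - ((i : ℝ) + 1)) := by
    calc ∏ i ∈ Finset.range k, ((i : ℝ) + 1 - s)
        = ∏ i ∈ Finset.range k, (-1) * (s - ((i : ℝ) + 1)) :=
          Finset.prod_congr rfl fun i _ => by ring
      _ = _ := by rw [Finset.prod_mul_distrib, Finset.prod_const, Finset.card_range]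
  rw [h, grunwald, Finset.prod_range_succ']
  push_cast
  ring

theorem sum_grunwald (s : ℝ) (k : ℕ) :
    ∑ j ∈ Finset.range (k + 1), grunwald s j =
      (∏ i ∈ Finset.range k, ((i : ℝ) + 1 - s)) / (Nat.factorial k : ℝ) := by
  induction k with
  | zero => simp [grunwald]
  | succ k ih =>
    rw [Finset.sum_range_succ, ih, grunwald_succ, Finset.prod_range_succ, Nat.factorial_succ]
    have hk : (Nat.factorial k : ℝ) ≠ 0 := by positivity
    push_cast
    field_simp
    ring

theorem stmt5 (β : ℝ) (hβ : β ∈ Set.Ioo (0 : ℝ) 1) :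
    ∀ k : ℕ, 0 < ∑ j ∈ Finset.range (k + 1), grunwald β j := by
  intro k
  rw [sum_grunwald]
  refine div_pos (Finset.prod_pos fun i _ => ?_) (by positivity)
  have hi : (0 : ℝ) ≤ i := i.cast_nonneg
  linarith [hβ.2]
end

section
/- For γ ∈ (1,2), there exists a constant C > 0 such that the tail of the Grünwald coefficients satisfies ∑_{j=ℓ}^{∞} |g_j^{(γ)}| ≤ C · ℓ^{−γ} for all ℓ ≥ 1; that is, the tail sum is O(ℓ^{−γ}). -/
theorem grunwald_succ_s10 (s : ℝ) (j : ℕ) :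
    (j + 1) * grunwald s (j + 1) = (j - s) * grunwald s j := by
  have h : (Nat.factorial j : ℝ) ≠ 0 := by positivity
  have h' : (j : ℝ) + 1 ≠ 0 := by positivity
  simp only [grunwald, Finset.prod_range_succ, Nat.factorial_succ, pow_succ]
  push_cast
  field_simp
  ring

theorem grunwald_one (s : ℝ) : grunwald s 1 = -s := by
  simp [grunwald]

theorem grunwald_two (s : ℝ) : grunwald s 2 = s * (s - 1) / 2 := by
  simp [grunwald, Finset.prod_range_succ]
  ring

theorem grunwald_nonneg {s : ℝ} (hs : s ∈ Set.Ioo (1 : ℝ) 2) {j : ℕ} (hj : 2 ≤ j) :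
    0 ≤ grunwald s j := by
  obtain ⟨h1, h2⟩ := hs
  induction j, hj using Nat.le_induction with
  | base =>
    rw [grunwald_two]
    have : 0 ≤ s * (s - 1) := mul_nonneg (by linarith) (by linarith)
    linarith
  | succ j hj ih =>
    have hj' : (2 : ℝ) ≤ j := by exact_mod_cast hj
    have h : 0 ≤ ((j : ℝ) + 1) * grunwald s (j + 1) := by
      rw [grunwald_succ_s10]
      exact mul_nonneg (by linarith) ih
    exact nonneg_of_mul_nonneg_right h (by positivity)

/-- The sum of consecutive Grünwald coefficients telescopes. -/
theorem mul_sum_grunwald (s : ℝ) (l n : ℕ) :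
    s * ∑ j ∈ Finset.range n, grunwald s (l + j) =
      l * grunwald s l - (l + n : ℕ) * grunwald s (l + n) := by
  induction n with
  | zero => simp
  | succ n ih =>
    have h := grunwald_succ_s10 s (l + n)
    rw [Finset.sum_range_succ, mul_add, ih, ← add_assoc]
    push_cast at h ⊢
    linarith

theorem mul_grunwald_le {s : ℝ} (hs : s ∈ Set.Ioo (1 : ℝ) 2) {l : ℕ} (hl : 2 ≤ l) :
    l * grunwald s l ≤ s * (4 * (l : ℝ) ^ (-s)) := by
  obtain ⟨h1, h2⟩ := id hs
  induction l, hl using Nat.le_induction with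
  | base =>
    have h : (2 : ℝ) ^ (-2 : ℝ) ≤ 2 ^ (-s) :=
      Real.rpow_le_rpow_of_exponent_le (by norm_num) (by linarith)
    have h' : (2 : ℝ) ^ (-2 : ℝ) = 1 / 4 := by
      rw [Real.rpow_neg (by norm_num)]
      norm_num
    rw [h'] at h
    rw [grunwald_two]
    push_cast
    rw [mul_div_cancel₀ _ (two_ne_zero' ℝ)]
    exact mul_le_mul_of_nonneg_left (by linarith) (by linarith)
  | succ j hj ih =>
    have hj' : (2 : ℝ) ≤ j := by exact_mod_cast hj
    have hj0 : (0 : ℝ) < j := by linarith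
    have bernoulli : 1 + s * (-1 / (j + 1)) ≤ (1 + -1 / ((j : ℝ) + 1)) ^ s := by
      refine one_add_mul_self_le_rpow_one_add ?_ h1.le
      rw [le_div_iff₀ (by positivity)]
      linarith
    have hbase : 1 + -1 / ((j : ℝ) + 1) = j / (j + 1) := by
      field_simp
      ring
    rw [hbase, Real.div_rpow hj0.le (by positivity)] at bernoulli
    have hratio : ((j : ℝ) - s) / j ≤ (j : ℝ) ^ s / ((j : ℝ) + 1) ^ s := by
      refine le_trans ?_ bernoulli
      rw [div_le_iff₀ hj0]
      have : s * j / (j + 1) ≤ s := by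
        rw [div_le_iff₀ (by positivity)]
        nlinarith
      have e : (1 + s * (-1 / ((j : ℝ) + 1))) * j = j - s * j / (j + 1) := by
        ring
      linarith
    push_cast
    calc ((j : ℝ) + 1) * grunwald s (j + 1)
        = (j - s) / j * (j * grunwald s j) := by
          rw [grunwald_succ_s10]
          field_simp
      _ ≤ (j : ℝ) ^ s / ((j : ℝ) + 1) ^ s * (s * (4 * (j : ℝ) ^ (-s))) :=
          mul_le_mul hratio ih (mul_nonneg hj0.le (grunwald_nonneg hs hj)) (by positivity)
      _ = s * (4 * ((j : ℝ) + 1) ^ (-s)) := by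
          have : (j : ℝ) ^ s ≠ 0 := (Real.rpow_pos_of_pos hj0 s).ne'
          rw [Real.rpow_neg hj0.le, Real.rpow_neg (by positivity)]
          field_simp

theorem sum_abs_grunwald_le {s : ℝ} (hs : s ∈ Set.Ioo (1 : ℝ) 2) {l : ℕ} (hl : 2 ≤ l) (n : ℕ) :
    s * ∑ j ∈ Finset.range n, |grunwald s (l + j)| ≤ l * grunwald s l := by
  have h : ∀ j, 0 ≤ grunwald s (l + j) := fun j => grunwald_nonneg hs (by omega)
  simp only [abs_of_nonneg (h _), mul_sum_grunwald]
  have := mul_nonneg (Nat.cast_nonneg (α := ℝ) (l + n)) (h n)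
  linarith

theorem stmt10 (γ : ℝ) (hγ : γ ∈ Set.Ioo (1 : ℝ) 2) :
    ∃ C : ℝ, 0 < C ∧ ∀ ℓ : ℕ, 1 ≤ ℓ →
      (Summable fun j : ℕ => |grunwald γ (ℓ + j)|) ∧
      ∑' j : ℕ, |grunwald γ (ℓ + j)| ≤ C * (ℓ : ℝ) ^ (-γ) := by
  have hγ0 : 0 < γ := by linarith [hγ.1]
  refine ⟨4, by norm_num, fun ℓ hℓ => ?_⟩
  have key : ∀ n, ∑ j ∈ Finset.range n, |grunwald γ (ℓ + j)| ≤ 4 * (ℓ : ℝ) ^ (-γ) := by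
    intro n
    rcases hℓ.eq_or_lt with rfl | hℓ
    · cases n with
      | zero => simp
      | succ n =>
        have h := sum_abs_grunwald_le hγ le_rfl n
        rw [grunwald_two] at h
        push_cast at h
        have h' : ∑ j ∈ Finset.range n, |grunwald γ (2 + j)| ≤ γ - 1 :=
          le_of_mul_le_mul_left (by linarith) hγ0
        have e : ∀ j, 1 + (j + 1) = 2 + j := fun j => by omega
        simp only [Finset.sum_range_succ', e, add_zero, grunwald_one, abs_neg, abs_of_pos hγ0,
          Nat.cast_one, Real.one_rpow]
        linarith [hγ.2]
    · exact le_of_mul_le_mul_left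
        ((sum_abs_grunwald_le hγ hℓ n).trans (mul_grunwald_le hγ hℓ)) hγ0
  exact ⟨summable_of_sum_range_le (fun _ => abs_nonneg _) key,
    Real.tsum_le_of_sum_range_le (fun _ => abs_nonneg _) key⟩
end
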